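/- Let F be a class of functions from ℝ^r to [0,1], and suppose W, D > 0 satisfy W·D ≥ 1 and the sup-norm covering numbers of F satisfy N(F, ‖·‖_∞, u) ≤ (1/u)·2^{2WD/u} for all u ∈ (0,1]. Then there is a universal constant C such that for every n-point dataset Z = (z_1,…,z_n) in ℝ^r, the empirical Gaussian complexity satisfies Ĝ_Z(F) ≤ C·√( W·D / n ). In particular this applies to the class of nondecreasing 1-Lipschitz functions ℝ→[0,1] restricted to inputs z = b^T x with ‖b‖₂ ≤ W and ‖x‖₂ ≤ D, for which the stated covering bound holds. -/

import Mathlib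

/-! Statement 19: a Dudley-type bound. If a class `F` of `[0,1]`-valued
functions has sup-norm covering numbers `N(F, ‖·‖_∞, u) ≤ (1/u)·2^{2WD/u}` for
all `u ∈ (0,1]` (with `WD ≥ 1`), then its empirical Gaussian complexity on any
`n`-point dataset is at most `C·√(WD/n)` for a universal constant `C`.  In
particular this applies to the class of nondecreasing 1-Lipschitz `[0,1]`-valued
functions on inputs `z = bᵀx` with `‖b‖₂ ≤ W`, `‖x‖₂ ≤ D`. -/

open MeasureTheory ProbabilityTheory Matrix

noncomputable section

/-- Euclidean norm of a vector given as a function. -/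
def eNorm {n : ℕ} (v : Fin n → ℝ) : ℝ := Real.sqrt (∑ i, v i ^ 2)

/-- Empirical Gaussian complexity of a class of real functions on a dataset. -/
def empGauss {α : Type*} {n : ℕ} (F : Set (α → ℝ)) (z : Fin n → α) : ℝ :=
  ∫ g : Fin n → ℝ, (⨆ f : F, (∑ i, g i * f.1 (z i)) / n)
    ∂(Measure.pi fun _ : Fin n => gaussianReal 0 1)

/-- The class of nondecreasing, 1-Lipschitz functions `ℝ → [0,1]`. -/
def monoLipClass : Set (ℝ → ℝ) :=
  {f | Monotone f ∧ LipschitzWith 1 f ∧ ∀ z, f z ∈ Set.Icc (0 : ℝ) 1}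

/-- The standard Gaussian measure on `ℝⁿ`. -/
abbrev stdG (n : ℕ) : Measure (Fin n → ℝ) := Measure.pi fun _ : Fin n => gaussianReal 0 1

lemma aux_integrable_exp {n : ℕ} (s : Fin n → ℝ) :
    Integrable (fun g : Fin n → ℝ => Real.exp (∑ i, g i * s i)) (stdG n) := by
  simp_rw [Real.exp_sum]
  exact Integrable.fintype_prod_dep (f := fun i x => Real.exp (x * s i)) (fun i => by
    simpa [mul_comm] using integrable_exp_mul_gaussianReal (μ := 0) (v := 1) (s i))

lemma aux_integral_exp {n : ℕ} (s : Fin n → ℝ) :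
    ∫ g : Fin n → ℝ, Real.exp (∑ i, g i * s i) ∂(stdG n) = Real.exp ((∑ i, s i ^ 2) / 2) := by
  simp_rw [Real.exp_sum]
  rw [integral_fintype_prod_eq_prod (fun i x => Real.exp (x * s i)), Finset.sum_div, Real.exp_sum]
  refine Finset.prod_congr rfl fun i _ => ?_
  have := mgf_gaussianReal (p := gaussianReal 0 1) (X := id) (μ := 0) (v := 1) (by simp) (s i)
  simp only [mgf, id] at this
  simp_rw [mul_comm _ (s i)]
  rw [this]
  simp

lemma aux_integrable_abs (n : ℕ) :
    Integrable (fun g : Fin n → ℝ => ∑ i, |g i|) (stdG n) := by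
  refine integrable_finsetSum _ fun i _ => Integrable.abs ?_
  have h : Integrable (fun x : ℝ => x) (gaussianReal 0 1) :=
    (memLp_id_gaussianReal (μ := 0) (v := 1) 1).integrable (by simp)
  exact (measurePreserving_eval (fun _ : Fin n => gaussianReal 0 1) i).integrable_comp_of_integrable h

/-- One chaining link. -/
lemma aux_link {n : ℕ} (hn : 0 < n) {M B : ℝ} (hM : 1 ≤ M) (hB : 0 ≤ B) (k : ℕ)
    (S : Finset (Fin n → ℝ)) (hc : (S.card : ℝ) ≤ Real.exp (3 * B * M * 2 ^ k))
    (hS : ∀ s ∈ S, ∀ i, |s i| ≤ 3 * (1 / 2) ^ (k + 1)) :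
    ∃ φ : (Fin n → ℝ) → ℝ, Integrable φ (stdG n) ∧
      (∀ g, ∀ s ∈ S, ∑ i, g i * s i ≤ φ g) ∧
      ∫ g, φ g ∂(stdG n) ≤ (3 * B + 2) * Real.sqrt (M * n) * (3 / 4) ^ k := by
  have hn' : (0 : ℝ) < n := by exact_mod_cast hn
  have hM0 : 0 < M := by linarith
  set R := Real.sqrt (M * n) with hR
  have hRpos : 0 < R := Real.sqrt_pos.2 (by positivity)
  have hR2 : R ^ 2 = M * n := Real.sq_sqrt (by positivity)
  set l : ℝ := R / n * 3 ^ k with hl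
  have hlpos : 0 < l := by positivity
  set v : ℝ := l ^ 2 * (n * (3 * (1 / 2) ^ (k + 1)) ^ 2) / 2 with hv
  set a : ℝ := 3 * B * M * 2 ^ k + v with ha
  have hint : ∀ s : Fin n → ℝ, Integrable
      (fun g : Fin n → ℝ => Real.exp (l * ∑ i, g i * s i - a)) (stdG n) := by
    intro s
    have := (aux_integrable_exp (fun i => l * s i)).mul_const (Real.exp (-a))
    refine this.congr (Filter.Eventually.of_forall fun g => ?_)
    simp only
    rw [← Real.exp_add, Finset.mul_sum, sub_eq_add_neg]
    congr 2
    exact Finset.sum_congr rfl fun i _ => by ring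
  have hval : ∀ s ∈ S, ∫ g : Fin n → ℝ, Real.exp (l * ∑ i, g i * s i - a) ∂(stdG n)
      ≤ Real.exp (- (3 * B * M * 2 ^ k)) := by
    intro s hs
    have h1 : ∀ g : Fin n → ℝ, Real.exp (l * ∑ i, g i * s i - a)
        = Real.exp (∑ i, g i * (l * s i)) * Real.exp (-a) := by
      intro g
      rw [← Real.exp_add, Finset.mul_sum, sub_eq_add_neg]
      congr 2
      exact Finset.sum_congr rfl fun i _ => by ring
    simp_rw [h1]
    rw [integral_mul_const, aux_integral_exp, ← Real.exp_add]
    apply Real.exp_le_exp.2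
    have h2 : ∑ i, (l * s i) ^ 2 ≤ ∑ _i : Fin n, l ^ 2 * (3 * (1 / 2) ^ (k + 1)) ^ 2 := by
      refine Finset.sum_le_sum fun i _ => ?_
      rw [mul_pow]
      refine mul_le_mul_of_nonneg_left ?_ (by positivity)
      rw [← sq_abs (s i)]
      exact pow_le_pow_left₀ (abs_nonneg _) (hS s hs i) 2
    simp only [Finset.sum_const, Finset.card_univ, Fintype.card_fin, nsmul_eq_mul] at h2
    rw [ha, hv]
    linarith
  refine ⟨fun g => (∑ s ∈ S, Real.exp (l * ∑ i, g i * s i - a) + (a - 1)) / l, ?_, ?_, ?_⟩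
  · exact ((integrable_finsetSum _ fun s _ => hint s).add (integrable_const _)).div_const _
  · intro g s hs
    rw [le_div_iff₀ hlpos]
    have h1 : Real.exp (l * ∑ i, g i * s i - a) ≤ ∑ s ∈ S, Real.exp (l * ∑ i, g i * s i - a) :=
      Finset.single_le_sum (f := fun s => Real.exp (l * ∑ i, g i * s i - a))
        (fun _ _ => (Real.exp_pos _).le) hs
    have h2 := Real.add_one_le_exp (l * ∑ i, g i * s i - a)
    linarith
  · rw [integral_div, integral_add (integrable_finsetSum _ fun s _ => hint s) (integrable_const _),
      integral_finsetSum _ fun s _ => hint s]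
    have h1 : ∑ s ∈ S, ∫ g : Fin n → ℝ, Real.exp (l * ∑ i, g i * s i - a) ∂(stdG n) ≤ 1 := by
      calc _ ≤ ∑ s ∈ S, Real.exp (- (3 * B * M * 2 ^ k)) := Finset.sum_le_sum hval
        _ = S.card * Real.exp (- (3 * B * M * 2 ^ k)) := by simp
        _ ≤ Real.exp (3 * B * M * 2 ^ k) * Real.exp (- (3 * B * M * 2 ^ k)) := by gcongr
        _ = 1 := by rw [← Real.exp_add]; simp
    rw [div_le_iff₀ hlpos]
    simp only [integral_const, probReal_univ, smul_eq_mul, one_mul]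
    have h2 : a ≤ (3 * B + 2) * R * (3 / 4) ^ k * l := by
      have e1 : R * l = M * 3 ^ k := by
        rw [hl]; field_simp; rw [hR2]; ring
      have e2 : v = 9 / 8 * M * (9 / 4) ^ k := by
        have : v = R ^ 2 / n * (9 / 8 * ((3 ^ k) ^ 2 * ((1 / 2) ^ k) ^ 2)) := by
          rw [hv, hl]; field_simp; ring
        have h9 : ((3 : ℝ) ^ k) ^ 2 * ((1 / 2) ^ k) ^ 2 = (9 / 4) ^ k := by
          rw [← mul_pow, ← mul_pow, ← pow_mul, mul_comm k 2, pow_mul]; norm_num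
        rw [this, hR2, h9]
        field_simp
      have e3 : (3 * B + 2) * R * (3 / 4) ^ k * l = (3 * B + 2) * M * (9 / 4) ^ k := by
        calc _ = (3 * B + 2) * (3 / 4) ^ k * (R * l) := by ring
          _ = (3 * B + 2) * M * ((3 / 4) ^ k * 3 ^ k) := by rw [e1]; ring
          _ = _ := by rw [← mul_pow]; norm_num
      rw [e3, ha, e2]
      have e4 : (2 : ℝ) ^ k ≤ (9 / 4) ^ k := by gcongr; norm_num
      have e5 : 3 * B * M * 2 ^ k ≤ 3 * B * M * (9 / 4) ^ k := by gcongr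
      have e6 : 0 ≤ M * (9 / 4 : ℝ) ^ k := by positivity
      nlinarith
    linarith

lemma aux_core {ι : Type*} {n : ℕ} (hn : 0 < n) {M B : ℝ} (hM : 1 ≤ M) (hB : 0 ≤ B)
    (v : ι → Fin n → ℝ) (hv : ∀ j i, |v j i| ≤ 1)
    (cov : ∀ k : ℕ, ∃ G : Finset (Fin n → ℝ),
      (∀ j, ∃ g ∈ G, ∀ i, |v j i - g i| ≤ (1 / 2) ^ k) ∧
      (G.card : ℝ) ≤ Real.exp (B * M * 2 ^ k)) :
    ∫ g : Fin n → ℝ, (⨆ j, (∑ i, g i * v j i) / n) ∂(stdG n)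
      ≤ (12 * B + 9) * Real.sqrt (M / n) := by
  have hn' : (0 : ℝ) < n := by exact_mod_cast hn
  have hM0 : 0 < M := by linarith
  rcases isEmpty_or_nonempty ι with hι | hι
  · simp only [Real.iSup_of_isEmpty, integral_zero]
    positivity
  have cov' : ∃ G : ℕ → Finset (Fin n → ℝ), G 0 = {0} ∧ ∀ k,
      (∀ j, ∃ g ∈ G k, ∀ i, |v j i - g i| ≤ (1 / 2) ^ k) ∧
      ((G k).card : ℝ) ≤ Real.exp (B * M * 2 ^ k) := by
    choose G hG using cov
    refine ⟨fun k => if k = 0 then {0} else G k, by simp, fun k => ?_⟩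
    by_cases hk : k = 0
    · subst hk
      simp only [if_true]
      refine ⟨fun j => ⟨0, by simp, fun i => by simpa using hv j i⟩, ?_⟩
      simp only [Finset.card_singleton, Nat.cast_one]
      exact Real.one_le_exp (by positivity)
    · simp only [hk, if_false]
      exact hG k
  obtain ⟨G, hG0, hG⟩ := cov'
  choose P hPG hP using fun k => (hG k).1
  have hP0 : ∀ j, P 0 j = 0 := fun j => by
    have := hPG 0 j; rw [hG0] at this; simpa using this
  set R := Real.sqrt (M * n) with hR
  have hRpos : 0 < R := Real.sqrt_pos.2 (by positivity)
  have link : ∀ k, ∃ φ : (Fin n → ℝ) → ℝ, Integrable φ (stdG n) ∧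
      (∀ g, ∀ j, ∑ i, g i * (P (k + 1) j i - P k j i) ≤ φ g) ∧
      ∫ g, φ g ∂(stdG n) ≤ (3 * B + 2) * R * (3 / 4) ^ k := by
    intro k
    classical
    let S : Finset (Fin n → ℝ) := ((G (k + 1) ×ˢ G k).image fun p => p.1 - p.2).filter
      fun s => ∀ i, |s i| ≤ 3 * (1 / 2) ^ (k + 1)
    have hS1 : (S.card : ℝ) ≤ Real.exp (3 * B * M * 2 ^ k) := by
      have c1 : S.card ≤ (G (k + 1)).card * (G k).card := by
        refine (Finset.card_filter_le _ _).trans (Finset.card_image_le.trans ?_)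
        rw [Finset.card_product]
      have c2 : (S.card : ℝ) ≤ (G (k + 1)).card * (G k).card := by exact_mod_cast c1
      calc (S.card : ℝ) ≤ (G (k + 1)).card * (G k).card := c2
        _ ≤ Real.exp (B * M * 2 ^ (k + 1)) * Real.exp (B * M * 2 ^ k) :=
          mul_le_mul (hG _).2 (hG _).2 (by positivity) (Real.exp_pos _).le
        _ = _ := by rw [← Real.exp_add]; congr 1; ring
    have hS2 : ∀ s ∈ S, ∀ i, |s i| ≤ 3 * (1 / 2) ^ (k + 1) := fun s hs =>
      (Finset.mem_filter.1 hs).2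
    obtain ⟨φ, h1, h2, h3⟩ := aux_link hn hM hB k S hS1 hS2
    refine ⟨φ, h1, fun g j => ?_, h3⟩
    refine h2 g (P (k + 1) j - P k j) ?_
    refine Finset.mem_filter.2 ⟨Finset.mem_image.2
      ⟨(P (k + 1) j, P k j), Finset.mem_product.2 ⟨hPG _ _, hPG _ _⟩, rfl⟩, fun i => ?_⟩
    have a1 := abs_le.1 (hP (k + 1) j i)
    have a2 := abs_le.1 (hP k j i)
    have e : (1 / 2 : ℝ) ^ (k + 1) = (1 / 2) ^ k / 2 := by ring
    rw [e] at a1 ⊢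
    simp only [Pi.sub_apply]
    rw [abs_le]
    constructor <;> linarith
  choose φ hφi hφ hφv using link
  set H := ∫ g : Fin n → ℝ, ∑ i, |g i| ∂(stdG n) with hH
  have hH0 : 0 ≤ H := integral_nonneg fun g => Finset.sum_nonneg fun i _ => abs_nonneg _
  obtain ⟨K, hK⟩ := exists_pow_lt_of_lt_one (show 0 < R / (H + 1) by positivity)
    (show (1 / 2 : ℝ) < 1 by norm_num)
  have hK' : (1 / 2 : ℝ) ^ K * H ≤ R := by
    rw [lt_div_iff₀ (by positivity)] at hK
    have : (0 : ℝ) < (1 / 2) ^ K := by positivity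
    linarith
  let Φ : (Fin n → ℝ) → ℝ := fun g =>
    ((1 / 2) ^ K * ∑ i, |g i| + ∑ k ∈ Finset.range K, φ k g) / n
  have hΦi1 : Integrable (fun g : Fin n → ℝ => (1 / 2 : ℝ) ^ K * ∑ i, |g i|) (stdG n) :=
    (aux_integrable_abs n).const_mul _
  have hΦi2 : Integrable (fun g : Fin n → ℝ => ∑ k ∈ Finset.range K, φ k g) (stdG n) :=
    integrable_finsetSum _ fun k _ => hφi k
  have hΦi : Integrable Φ (stdG n) := (hΦi1.add hΦi2).div_const _
  have hpt : ∀ g : Fin n → ℝ, (⨆ j, (∑ i, g i * v j i) / (n : ℝ)) ≤ Φ g := by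
    intro g
    refine ciSup_le fun j => ?_
    refine div_le_div_of_nonneg_right ?_ hn'.le
    have e : ∀ i, v j i = (v j i - P K j i) + ∑ k ∈ Finset.range K, (P (k + 1) j i - P k j i) := by
      intro i
      rw [Finset.sum_range_sub (fun k => P k j i), hP0]
      simp
    calc ∑ i, g i * v j i
        = ∑ i, g i * (v j i - P K j i)
          + ∑ k ∈ Finset.range K, ∑ i, g i * (P (k + 1) j i - P k j i) := by
          rw [Finset.sum_comm, ← Finset.sum_add_distrib]
          refine Finset.sum_congr rfl fun i _ => ?_
          rw [← Finset.mul_sum, ← mul_add, ← e]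
      _ ≤ _ := by
          refine add_le_add ?_ (Finset.sum_le_sum fun k _ => hφ k g j)
          rw [Finset.mul_sum]
          refine Finset.sum_le_sum fun i _ => ?_
          calc g i * (v j i - P K j i) ≤ |g i * (v j i - P K j i)| := le_abs_self _
            _ = |v j i - P K j i| * |g i| := by rw [abs_mul, mul_comm]
            _ ≤ _ := mul_le_mul_of_nonneg_right (hP K j i) (abs_nonneg _)
  have hgeo : ∑ k ∈ Finset.range K, (3 / 4 : ℝ) ^ k ≤ 4 := by
    rw [geom_sum_eq (by norm_num)]
    have : (0 : ℝ) < (3 / 4) ^ K := by positivity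
    rw [div_le_iff_of_neg (by norm_num)]
    linarith
  have hΦv : ∫ g, Φ g ∂(stdG n) ≤ (12 * B + 9) * Real.sqrt (M / n) := by
    have e1 : ∫ g, Φ g ∂(stdG n) = ((1 / 2) ^ K * H
        + ∑ k ∈ Finset.range K, ∫ g, φ k g ∂(stdG n)) / n := by
      simp only [Φ]
      rw [integral_div, integral_add hΦi1 hΦi2, integral_const_mul,
        integral_finsetSum _ fun k _ => hφi k]
    have e2 : ∑ k ∈ Finset.range K, ∫ g, φ k g ∂(stdG n) ≤ (3 * B + 2) * R * 4 := by
      calc _ ≤ ∑ k ∈ Finset.range K, (3 * B + 2) * R * (3 / 4) ^ k :=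
            Finset.sum_le_sum fun k _ => hφv k
        _ ≤ _ := by
            rw [← Finset.mul_sum]
            exact mul_le_mul_of_nonneg_left hgeo (by positivity)
    have e3 : Real.sqrt (M / n) = R / n := by
      rw [hR, Real.sqrt_eq_iff_mul_self_eq (by positivity) (by positivity), div_mul_div_comm,
        Real.mul_self_sqrt (by positivity)]
      field_simp
    rw [e1, e3, ← mul_div_assoc]
    refine div_le_div_of_nonneg_right ?_ hn'.le
    linarith
  by_cases hI : Integrable (fun g : Fin n → ℝ => ⨆ j, (∑ i, g i * v j i) / (n : ℝ)) (stdG n)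
  · exact (integral_mono hI hΦi hpt).trans hΦv
  · rw [integral_undef hI]
    positivity

lemma aux_code {ι κ : Type*} [Fintype κ] {n : ℕ} (v : ι → Fin n → ℝ) (c : ι → κ) (u : ℝ)
    (h : ∀ j j', c j = c j' → ∀ i, |v j i - v j' i| ≤ u) :
    ∃ G : Finset (Fin n → ℝ), (∀ j, ∃ g ∈ G, ∀ i, |v j i - g i| ≤ u) ∧
      G.card ≤ Fintype.card κ := by
  classical
  refine ⟨Finset.univ.image fun k : κ => if hk : ∃ j, c j = k then v hk.choose else 0, ?_,
    Finset.card_image_le⟩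
  intro j
  have hk : ∃ j', c j' = c j := ⟨j, rfl⟩
  refine ⟨v hk.choose, Finset.mem_image.2 ⟨c j, Finset.mem_univ _, by rw [dif_pos hk]⟩, ?_⟩
  exact h _ _ hk.choose_spec.symm

lemma aux_mono {n : ℕ} {M : ℝ} (hM : 1 ≤ M) (z : Fin n → ℝ) (hz : ∀ i, |z i| ≤ M) (k : ℕ) :
    ∃ G : Finset (Fin n → ℝ),
      (∀ f : monoLipClass, ∃ g ∈ G, ∀ i, |f.1 (z i) - g i| ≤ (1 / 2) ^ k) ∧
      (G.card : ℝ) ≤ Real.exp (7 * M * 2 ^ k) := by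
  set N : ℕ := 2 * 2 ^ k with hN
  have hNpos : (0 : ℝ) < N := by rw [hN]; positivity
  set K : ℕ := ⌈2 * M * N⌉₊ with hKdef
  let p : monoLipClass → ℕ → ℕ := fun f j => ⌊N * f.1 (-M + j / N)⌋₊
  have hlip : ∀ (f : monoLipClass) (x y : ℝ), x ≤ y → f.1 y ≤ f.1 x + (y - x) := by
    intro f x y hxy
    have := f.2.2.1.dist_le_mul y x
    rw [Real.dist_eq, Real.dist_eq, abs_of_nonneg (sub_nonneg.2 hxy)] at this
    have := (abs_le.1 this).2
    simp at this
    linarith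
  have hp0 : ∀ f j, p f j < N + 1 := by
    intro f j
    have h1 := (f.2.2.2 (-M + j / N)).2
    have : p f j ≤ N := by
      apply Nat.floor_le_of_le
      nlinarith
    omega
  have hpl : ∀ (f : monoLipClass) j, (p f j : ℝ) ≤ N * f.1 (-M + j / N) := fun f j =>
    Nat.floor_le (mul_nonneg hNpos.le (f.2.2.2 _).1)
  have hpu : ∀ (f : monoLipClass) (j : ℕ), N * f.1 (-M + j / N) < p f j + 1 := fun f j =>
    Nat.lt_floor_add_one _
  have hstep : ∀ f j, p f (j + 1) = p f j ∨ p f (j + 1) = p f j + 1 := by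
    intro f j
    have hle : (-M + (j : ℝ) / N) ≤ -M + ((j + 1 : ℕ) : ℝ) / N := by
      push_cast; gcongr; linarith
    have h1 : p f j ≤ p f (j + 1) := by
      apply Nat.floor_le_floor
      exact mul_le_mul_of_nonneg_left (f.2.1 hle) hNpos.le
    have h2 : p f (j + 1) < p f j + 2 := by
      have a := hlip f _ _ hle
      have b := hpu f j
      have c := hpl f (j + 1)
      have d : N * f.1 (-M + ((j + 1 : ℕ) : ℝ) / N) ≤ N * f.1 (-M + (j : ℝ) / N) + 1 := by
        have := mul_le_mul_of_nonneg_left a hNpos.le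
        refine this.trans (le_of_eq ?_)
        push_cast; field_simp; ring
      have : (p f (j + 1) : ℝ) < p f j + 2 := by linarith
      exact_mod_cast this
    omega
  obtain ⟨G, hG1, hG2⟩ := aux_code (κ := Fin (N + 1) × (Fin K → Bool))
    (fun (f : monoLipClass) i => f.1 (z i))
    (fun f => (⟨p f 0, hp0 f 0⟩, fun j => decide (p f (j + 1) = p f j))) ((1 / 2) ^ k) (by
      intro f f' hff i
      simp only [Prod.mk.injEq, Fin.mk.injEq] at hff
      obtain ⟨h0, hj⟩ := hff
      have heq : ∀ j, j ≤ K → p f j = p f' j := by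
        intro j
        induction j with
        | zero => intro _; exact h0
        | succ j ih =>
          intro hjK
          have e := ih (by omega)
          have d := congrFun hj ⟨j, by omega⟩
          simp only [decide_eq_decide] at d
          have s1 := hstep f j
          have s2 := hstep f' j
          omega
      have hzi := abs_le.1 (hz i)
      set j : ℕ := ⌊N * (z i + M)⌋₊ with hjdef
      have hnn : 0 ≤ N * (z i + M) := mul_nonneg hNpos.le (by linarith)
      have hjl : (j : ℝ) ≤ N * (z i + M) := Nat.floor_le hnn
      have hju : N * (z i + M) < j + 1 := Nat.lt_floor_add_one _
      have hjK : j ≤ K := by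
        have h1 : (j : ℝ) ≤ 2 * M * N := by nlinarith
        have h2 : 2 * M * N ≤ (K : ℝ) := Nat.le_ceil _
        exact_mod_cast h1.trans h2
      have hx1 : -M + (j : ℝ) / N ≤ z i := by
        have : (j : ℝ) / N ≤ z i + M := by rw [div_le_iff₀ hNpos]; linarith
        linarith
      have key : ∀ f : monoLipClass, (p f j : ℝ) ≤ N * f.1 (z i) ∧ N * f.1 (z i) ≤ p f j + 2 := by
        intro f
        constructor
        · exact (hpl f j).trans (mul_le_mul_of_nonneg_left (f.2.1 hx1) hNpos.le)
        · have a := mul_le_mul_of_nonneg_left (hlip f _ _ hx1) hNpos.le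
          have b := hpu f j
          have c : (N : ℝ) * (f.1 (-M + j / N) + (z i - (-M + j / N)))
              = N * f.1 (-M + j / N) + (N * (z i + M) - j) := by field_simp; ring
          linarith
      have k1 := key f
      have k2 := key f'
      rw [← heq j hjK] at k2
      have hN2 : (N : ℝ) * (1 / 2) ^ k = 2 := by
        rw [hN]; push_cast
        rw [mul_assoc, ← mul_pow]; norm_num
      rw [abs_le]
      constructor <;> nlinarith)
  refine ⟨G, hG1, ?_⟩
  have hc : (G.card : ℝ) ≤ (N + 1) * 2 ^ K := by
    have : G.card ≤ (N + 1) * 2 ^ K := by simpa using hG2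
    exact_mod_cast this
  have h2k : (1 : ℝ) ≤ 2 ^ k := one_le_pow₀ (by norm_num)
  have hNr : (N : ℝ) = 2 * 2 ^ k := by rw [hN]; push_cast; ring
  have hKr : (K : ℝ) ≤ 2 * M * N + 1 := (Nat.ceil_lt_add_one (by positivity)).le
  calc (G.card : ℝ) ≤ (N + 1) * 2 ^ K := hc
    _ ≤ Real.exp N * Real.exp 1 ^ K := by
        gcongr
        · exact Real.add_one_le_exp _
        · have := Real.add_one_le_exp (1 : ℝ); linarith
    _ = Real.exp (N + K) := by rw [← Real.exp_nat_mul, mul_one, Real.exp_add]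
    _ ≤ _ := by
        apply Real.exp_le_exp.2
        rw [hNr] at hKr ⊢
        nlinarith

theorem gaussian_complexity_from_sup_covering :
    ∃ Cu : ℝ, 0 < Cu ∧
      (∀ (r n : ℕ) (F : Set ((Fin r → ℝ) → ℝ)) (W D : ℝ),
        0 < n → 0 < W → 0 < D → 1 ≤ W * D →
        (∀ f ∈ F, ∀ z, f z ∈ Set.Icc (0 : ℝ) 1) →
        (∀ u : ℝ, 0 < u → u ≤ 1 →
          ∃ G : Finset ((Fin r → ℝ) → ℝ),
            (∀ f ∈ F, ∃ g ∈ G, ∀ z, |f z - g z| ≤ u) ∧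
            (G.card : ℝ) ≤ (1 / u) * (2 : ℝ) ^ (2 * W * D / u)) →
        ∀ Z : Fin n → (Fin r → ℝ),
          empGauss F Z ≤ Cu * Real.sqrt (W * D / n)) ∧
      -- In particular: nondecreasing 1-Lipschitz [0,1]-valued functions of
      -- one-dimensional projections `z = bᵀx` with ‖b‖ ≤ W and ‖x‖ ≤ D.
      (∀ (dd n : ℕ) (W D : ℝ), 0 < n → 0 < W → 0 < D → 1 ≤ W * D →
        ∀ (b : Fin dd → ℝ), eNorm b ≤ W →
        ∀ (x : Fin n → (Fin dd → ℝ)), (∀ i, eNorm (x i) ≤ D) →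
          empGauss monoLipClass (fun i => b ⬝ᵥ (x i)) ≤ Cu * Real.sqrt (W * D / n)) := by
  refine ⟨12 * 7 + 9, by norm_num, ?_, ?_⟩
  · intro r n F W D hn hW hD hWD hF hcov Z
    refine aux_core (B := 7) hn hWD (by norm_num) (fun (f : F) i => f.1 (Z i)) ?_ ?_
    · intro f i
      have := hF f.1 f.2 (Z i)
      rw [abs_le]
      constructor <;> linarith [this.1, this.2]
    · intro k
      classical
      obtain ⟨G, hG1, hG2⟩ := hcov ((1 / 2) ^ k) (by positivity)
        (pow_le_one₀ (by norm_num) (by norm_num))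
      refine ⟨G.image fun g i => g (Z i), ?_, ?_⟩
      · intro f
        obtain ⟨g, hg, h⟩ := hG1 f.1 f.2
        exact ⟨_, Finset.mem_image_of_mem _ hg, fun i => h (Z i)⟩
      · have h2k : (1 : ℝ) ≤ 2 ^ k := one_le_pow₀ (by norm_num)
        have e : (1 : ℝ) / (1 / 2) ^ k = 2 ^ k := by simp
        have e' : 2 * W * D / (1 / 2) ^ k = 2 * (W * D) * 2 ^ k := by
          rw [← e]; ring
        rw [e, e'] at hG2
        have hle : ((G.image fun (g : (Fin r → ℝ) → ℝ) (i : Fin n) => g (Z i)).card : ℝ) ≤ G.card := by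
          exact_mod_cast Finset.card_image_le
        calc _ ≤ (G.card : ℝ) := hle
          _ ≤ _ := hG2
          _ ≤ Real.exp (2 ^ k) * (Real.exp 1) ^ (2 * (W * D) * 2 ^ k) := by
              gcongr
              · have := Real.add_one_le_exp ((2 : ℝ) ^ k); linarith
              · have := Real.add_one_le_exp (1 : ℝ); linarith
          _ = Real.exp (2 ^ k + 2 * (W * D) * 2 ^ k) := by
              rw [Real.exp_one_rpow, Real.exp_add]
          _ ≤ _ := by
              apply Real.exp_le_exp.2
              nlinarith
  · intro dd n W D hn hW hD hWD b hb x hx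
    refine aux_core (B := 7) hn hWD (by norm_num)
      (fun (f : monoLipClass) i => f.1 (b ⬝ᵥ x i)) ?_ ?_
    · intro f i
      have := f.2.2.2 (b ⬝ᵥ x i)
      rw [abs_le]
      constructor <;> linarith [this.1, this.2]
    · refine aux_mono hWD (fun i => b ⬝ᵥ x i) fun i => ?_
      have h1 : (b ⬝ᵥ x i) ^ 2 ≤ (∑ j, b j ^ 2) * ∑ j, x i j ^ 2 :=
        Finset.sum_mul_sq_le_sq_mul_sq _ _ _
      have h2 : |b ⬝ᵥ x i| ≤ eNorm b * eNorm (x i) := by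
        rw [eNorm, eNorm, ← Real.sqrt_mul (Finset.sum_nonneg fun _ _ => sq_nonneg _)]
        exact Real.abs_le_sqrt h1
      exact h2.trans (mul_le_mul hb (hx i) (Real.sqrt_nonneg _) hW.le)

end
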